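/- There exists an absolute constant C > 0 such that for every τ ∈ [0,1] and every (P_maj, P_min) ∈ P_GS(τ), the expected excess risk of the undersampled binning estimator A_USB with K = ⌈n_min^{1/3}⌉ bins satisfies E_{S ~ P_maj^{n_maj} × P_min^{n_min}}[R(A_USB^S; P_test) − R(f*; P_test)] ≤ C/n_min^{1/3}. -/

import Mathlib

open MeasureTheory Set
open scoped ENNReal Classical

noncomputable section

/-! ## Basic setup: distributions on `ℝ × Bool`, risk, excess risk.

A labelled example is a pair `(x, y) : ℝ × Bool`, where the label `true` codes `+1`
and `false` codes `-1`; features are supported on `[0,1]`. -/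

/-- The risk (probability of misclassification) of a classifier `f : ℝ → Bool`
under a distribution `P` on `ℝ × Bool`. -/
def risk (f : ℝ → Bool) (P : Measure (ℝ × Bool)) : ℝ :=
  (P {p : ℝ × Bool | f p.1 ≠ p.2}).toReal

/-- The Bayes risk of a distribution: the infimum of the risk over all classifiers. -/
def bayesRisk (P : Measure (ℝ × Bool)) : ℝ :=
  ⨅ f : ℝ → Bool, risk f P

/-- The balanced test distribution `P_test = (1/2) P_maj + (1/2) P_min`. -/
def testMeasure (Pmaj Pmin : Measure (ℝ × Bool)) : Measure (ℝ × Bool) :=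
  (2 : ℝ≥0∞)⁻¹ • Pmaj + (2 : ℝ≥0∞)⁻¹ • Pmin

/-- A training sample: `nmaj` labelled points from the majority distribution and
`nmin` labelled points from the minority distribution. -/
abbrev Sample (nmaj nmin : ℕ) : Type :=
  (Fin nmaj → ℝ × Bool) × (Fin nmin → ℝ × Bool)

/-- The law `P_maj^{n_maj} × P_min^{n_min}` of the training sample. -/
def sampleMeasure (nmaj nmin : ℕ) (Pmaj Pmin : Measure (ℝ × Bool)) :
    Measure (Sample nmaj nmin) :=
  (Measure.pi fun _ : Fin nmaj => Pmaj).prod (Measure.pi fun _ : Fin nmin => Pmin)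

/-- An algorithm (a map from samples to classifiers) is measurable if the joint map
`(S, x) ↦ A S x` is measurable. -/
def MeasurableAlg (nmaj nmin : ℕ) (A : Sample nmaj nmin → ℝ → Bool) : Prop :=
  Measurable fun p : Sample nmaj nmin × ℝ => A p.1 p.2

/-- The expected excess risk of the algorithm `A` on the pair `(P_maj, P_min)`:
`E_{S ~ P_maj^{n_maj} × P_min^{n_min}}[R(A^S; P_test)] - R(f^*; P_test)`. -/
def excessRisk (nmaj nmin : ℕ) (A : Sample nmaj nmin → ℝ → Bool)
    (Pmaj Pmin : Measure (ℝ × Bool)) : ℝ :=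
  (∫ S, risk (A S) (testMeasure Pmaj Pmin) ∂sampleMeasure nmaj nmin Pmaj Pmin)
    - bayesRisk (testMeasure Pmaj Pmin)

/-- The distribution on `ℝ × Bool` supported on label `y` whose feature has density `p`
(w.r.t. Lebesgue measure) on `[0,1]`. -/
def labelMeasure (p : ℝ → ℝ) (y : Bool) : Measure (ℝ × Bool) :=
  Measure.map (fun x => (x, y))
    ((volume.restrict (Icc (0:ℝ) 1)).withDensity fun x => ENNReal.ofReal (p x))

/-- The label-shift class `𝒫_LS`: `P_maj(x,y) = P₁(x)·1{y = 1}`,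
`P_min(x,y) = P₋₁(x)·1{y = -1}` with `P₁, P₋₁` 1-Lipschitz densities on `[0,1]`. -/
def memLS (Pmaj Pmin : Measure (ℝ × Bool)) : Prop :=
  ∃ p1 pm1 : ℝ → ℝ,
    (∀ x, 0 ≤ p1 x) ∧ (∀ x, 0 ≤ pm1 x) ∧
    LipschitzOnWith 1 p1 (Icc 0 1) ∧ LipschitzOnWith 1 pm1 (Icc 0 1) ∧
    (∫ x in Icc (0:ℝ) 1, p1 x) = 1 ∧ (∫ x in Icc (0:ℝ) 1, pm1 x) = 1 ∧
    Pmaj = labelMeasure p1 true ∧ Pmin = labelMeasure pm1 false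

/-- Total variation distance between two densities on `[0,1]`:
`TV(p, q) = (1/2)∫₀¹ |p - q|`. -/
def tvDist (p q : ℝ → ℝ) : ℝ :=
  (1/2) * ∫ x in Icc (0:ℝ) 1, |p x - q x|

/-- The distribution on `ℝ × Bool` whose feature has density `p` on `[0,1]` and whose
label is `true` with probability `η x` conditionally on the feature `x`. -/
def covMeasure (p η : ℝ → ℝ) : Measure (ℝ × Bool) :=
  labelMeasure (fun x => p x * η x) true + labelMeasure (fun x => p x * (1 - η x)) false

/-- The group-covariate shift class `𝒫_GS(τ)`: `P_maj(x,y) = P_a(x)·P(y|x)`,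
`P_min(x,y) = P_b(x)·P(y|x)` with group densities `P_a, P_b` on `[0,1]`,
a shared 1-Lipschitz conditional label distribution, and overlap
`1 - TV(P_a, P_b) ≥ τ`. -/
def memGS (τ : ℝ) (Pmaj Pmin : Measure (ℝ × Bool)) : Prop :=
  ∃ pa pb η : ℝ → ℝ,
    (∀ x, 0 ≤ pa x) ∧ (∀ x, 0 ≤ pb x) ∧
    (∫ x in Icc (0:ℝ) 1, pa x) = 1 ∧ (∫ x in Icc (0:ℝ) 1, pb x) = 1 ∧
    (∀ x, 0 ≤ η x ∧ η x ≤ 1) ∧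
    LipschitzOnWith 1 η (Icc 0 1) ∧ LipschitzOnWith 1 (fun x => 1 - η x) (Icc 0 1) ∧
    τ ≤ 1 - tvDist pa pb ∧
    Pmaj = covMeasure pa η ∧ Pmin = covMeasure pb η

/-! ## The hat function -/

/-- The hat function `φ_K`. -/
def hatFun (K : ℕ) (x : ℝ) : ℝ :=
  if x ∈ Icc (-(1/(2*(K:ℝ)))) 0 then |x + 1/(4*(K:ℝ))| - 1/(4*(K:ℝ))
  else if x ∈ Icc (0:ℝ) (1/(2*(K:ℝ))) then 1/(4*(K:ℝ)) - |x - 1/(4*(K:ℝ))|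
  else 0

/-! ## The hard family for the label-shift lower bound.

Bins are 0-indexed: `I_j = [j/K, (j+1)/K)` for `j = 0, …, K-1`, corresponding to the
paper's `I_{j+1} = [((j+1)-1)/K, (j+1)/K]`; the bin center is `(j + 1/2)/K`. -/

/-- The value in `{-1, 0, 1}` coded by an element of `Fin 3`. -/
def trit (i : Fin 3) : ℝ := (i : ℝ) - 1

/-- The perturbed density of the hard label-shift family: on the bin
`I_j = [j/K, (j+1)/K)` it equals `1 + v_j · φ_K(x - (j + 1/2)/K)`. -/
def hardDensityLS (K : ℕ) (v : Fin K → Fin 3) (x : ℝ) : ℝ :=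
  1 + ∑ j : Fin K,
    (if x ∈ Ico ((j:ℝ)/(K:ℝ)) (((j:ℝ)+1)/(K:ℝ))
      then trit (v j) * hatFun K (x - ((j:ℝ) + 1/2)/(K:ℝ)) else 0)

/-- The index set `𝒱 = {-1,0,1}^K × {-1,0,1}^K` of the hard label-shift family. -/
abbrev TritPair (K : ℕ) : Type := (Fin K → Fin 3) × (Fin K → Fin 3)

/-- The law `Q(S | v) = P_{v,maj}^{n_maj} × P_{v,min}^{n_min}` of the sample for the hard
label-shift instance indexed by `v`. -/
def hardLSMeasure (K nmaj nmin : ℕ) (v : TritPair K) : Measure (Sample nmaj nmin) :=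
  sampleMeasure nmaj nmin (labelMeasure (hardDensityLS K v.1) true)
    (labelMeasure (hardDensityLS K v.2) false)

/-- The marginal law `Q_S` of the sample when the index `V` is uniform on `𝒱`. -/
def hardLSMarginal (K nmaj nmin : ℕ) : Measure (Sample nmaj nmin) :=
  ∑ v : TritPair K, (Fintype.card (TritPair K) : ℝ≥0∞)⁻¹ • hardLSMeasure K nmaj nmin v

/-- The posterior weight `Q(v | S)`: the Radon–Nikodym derivative of
`(1/|𝒱|) · Q(S | v)` with respect to `Q_S`, evaluated at `S`. -/
def postLS (K nmaj nmin : ℕ) (v : TritPair K) (S : Sample nmaj nmin) : ℝ :=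
  (((Fintype.card (TritPair K) : ℝ≥0∞)⁻¹ • hardLSMeasure K nmaj nmin v).rnDeriv
      (hardLSMarginal K nmaj nmin) S).toReal

/-- The posterior mixture density `Σ_{v ∈ 𝒱} Q(v | S) · P_{v, ±1}`;
`cls = true` selects the class `+1` densities `P_{v,1}`. -/
def postMixLS (K nmaj nmin : ℕ) (S : Sample nmaj nmin) (cls : Bool) (x : ℝ) : ℝ :=
  ∑ v : TritPair K,
    postLS K nmaj nmin v S * hardDensityLS K (if cls then v.1 else v.2) x

/-! ## The hard family for the group-covariate shift lower bound -/

/-- The sign `+1` / `-1` coded by a Bool. -/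
def sgnB (b : Bool) : ℝ := if b then 1 else -1

/-- `P_v(y = 1 | x)` for the hard group-shift family: on the bin `I_j = [j/K, (j+1)/K)` it
equals `(1/2)(1 + v_j · φ_K(x - (j+1/2)/K))`. -/
def hardEta (K : ℕ) (v : Fin K → Bool) (x : ℝ) : ℝ :=
  (1/2) * (1 + ∑ j : Fin K,
    (if x ∈ Ico ((j:ℝ)/(K:ℝ)) (((j:ℝ)+1)/(K:ℝ))
      then sgnB (v j) * hatFun K (x - ((j:ℝ) + 1/2)/(K:ℝ)) else 0))

/-- The majority-group feature density: `2 - τ` on `[0, 1/2)` and `τ` on `[1/2, 1]`. -/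
def hardPa (τ : ℝ) (x : ℝ) : ℝ := if x < 1/2 then 2 - τ else τ

/-- The minority-group feature density `P_b = 2 - P_a`. -/
def hardPb (τ : ℝ) (x : ℝ) : ℝ := 2 - hardPa τ x

/-- The law `Q(S | v)` of the sample for the hard group-shift instance indexed by `v`. -/
def hardGSMeasure (K nmaj nmin : ℕ) (τ : ℝ) (v : Fin K → Bool) :
    Measure (Sample nmaj nmin) :=
  sampleMeasure nmaj nmin (covMeasure (hardPa τ) (hardEta K v))
    (covMeasure (hardPb τ) (hardEta K v))

/-- The conditional law `Q(S | v_j = b)` of the sample given the `j`-th coordinate of the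
uniformly random index: the uniform mixture over all `v` with `v_j = b`. -/
def condGS (K nmaj nmin : ℕ) (τ : ℝ) (j : Fin K) (b : Bool) :
    Measure (Sample nmaj nmin) :=
  ((Finset.univ.filter fun v : Fin K → Bool => v j = b).card : ℝ≥0∞)⁻¹ •
    ∑ v ∈ Finset.univ.filter (fun v : Fin K → Bool => v j = b),
      hardGSMeasure K nmaj nmin τ v

/-- The Kullback–Leibler divergence `KL(μ ‖ ν) = ∫ log (dμ/dν) dμ`. -/
def klDiv' {α : Type*} [MeasurableSpace α] (μ ν : Measure α) : ℝ :=
  ∫ x, Real.log ((μ.rnDeriv ν x).toReal) ∂μ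

/-! ## The undersampled binning estimator -/

/-- The prediction of the undersampled binning estimator on the bin `I_j = [j/K, (j+1)/K)`
(0-indexed), where `s ⊆ Fin nmaj` is the set of retained majority samples: predict `+1`
iff the samples of the undersampled dataset in the bin with label `+1` strictly
outnumber those with label `-1`. -/
def usbBinPred (nmaj nmin K : ℕ) (s : Finset (Fin nmaj)) (S : Sample nmaj nmin)
    (j : ℕ) : Bool :=
  decide
    ((s.filter fun i => (S.1 i).2 = false ∧
        (S.1 i).1 ∈ Ico ((j:ℝ)/(K:ℝ)) (((j:ℝ)+1)/(K:ℝ))).card +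
      (Finset.univ.filter fun i : Fin nmin => (S.2 i).2 = false ∧
        (S.2 i).1 ∈ Ico ((j:ℝ)/(K:ℝ)) (((j:ℝ)+1)/(K:ℝ))).card
      <
      (s.filter fun i => (S.1 i).2 = true ∧
        (S.1 i).1 ∈ Ico ((j:ℝ)/(K:ℝ)) (((j:ℝ)+1)/(K:ℝ))).card +
      (Finset.univ.filter fun i : Fin nmin => (S.2 i).2 = true ∧
        (S.2 i).1 ∈ Ico ((j:ℝ)/(K:ℝ)) (((j:ℝ)+1)/(K:ℝ))).card)

/-- The undersampled binning classifier `A_USB^{S,K}` with `K` bins, given the retained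
majority samples `s`: on each bin it predicts the majority label among the undersampled
data in that bin. -/
def usbClassifier (nmaj nmin K : ℕ) (s : Finset (Fin nmaj)) (S : Sample nmaj nmin) :
    ℝ → Bool :=
  fun x => usbBinPred nmaj nmin K s S (min ⌊x * (K:ℝ)⌋₊ (K - 1))

/-- The expected excess risk of the undersampled binning estimator with `K` bins, where the
`nmin` retained majority samples are drawn uniformly at random without replacement
(uniformly among all subsets of size `nmin`). -/
def usbExcessRisk (nmaj nmin K : ℕ) (Pmaj Pmin : Measure (ℝ × Bool)) : ℝ :=
  (∑ s ∈ Finset.powersetCard nmin (Finset.univ : Finset (Fin nmaj)),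
      ∫ S, risk (usbClassifier nmaj nmin K s S) (testMeasure Pmaj Pmin)
        ∂sampleMeasure nmaj nmin Pmaj Pmin)
    / ((Finset.powersetCard nmin (Finset.univ : Finset (Fin nmaj))).card : ℝ)
  - bayesRisk (testMeasure Pmaj Pmin)

/-- `q_{j,y} = P(y | x ∈ I_j)` for the 0-indexed bin `I_j = [j/K, (j+1)/K)`. -/
def qBin (P : Measure (ℝ × Bool)) (K j : ℕ) (y : Bool) : ℝ :=
  (P ((Ico ((j:ℝ)/(K:ℝ)) (((j:ℝ)+1)/(K:ℝ))) ×ˢ ({y} : Set Bool))).toReal /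
    (P ((Ico ((j:ℝ)/(K:ℝ)) (((j:ℝ)+1)/(K:ℝ))) ×ˢ (univ : Set Bool))).toReal

/-- The excess risk of the binning estimator in the bin `I_j`:
`R_j(A_USB^S) = q_{j, -A_j^S} - min{q_{j,1}, q_{j,-1}}`. -/
def binExcess (nmaj nmin K : ℕ) (s : Finset (Fin nmaj)) (S : Sample nmaj nmin)
    (P : Measure (ℝ × Bool)) (j : ℕ) : ℝ :=
  qBin P K j (!(usbBinPred nmaj nmin K s S j)) - min (qBin P K j true) (qBin P K j false)

/-- The binomial probability mass function `P[Bin(m, p) = k]`. -/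
def binomPMF (m : ℕ) (p : ℝ) (k : ℕ) : ℝ :=
  (m.choose k : ℝ) * p ^ k * (1 - p) ^ (m - k)

/-! ## Binomial-type concentration on product spaces -/

lemma integral_abs_le_sqrt_integral_sq {Ω : Type*} [MeasurableSpace Ω] {μ : Measure Ω}
    [IsProbabilityMeasure μ] {Y : Ω → ℝ} (hY : MemLp Y 2 μ) :
    ∫ ω, |Y ω| ∂μ ≤ √(∫ ω, Y ω ^ 2 ∂μ) := by
  apply Real.le_sqrt_of_sq_le
  have h := ProbabilityTheory.variance_nonneg (fun ω => |Y ω|) μ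
  rw [ProbabilityTheory.variance_eq_sub (by simpa using hY.norm)] at h
  simp only [Pi.pow_apply, sq_abs] at h
  linarith

lemma memLp_sum_eval {α : Type*} [MeasurableSpace α] {P : Measure α} [IsProbabilityMeasure P]
    {N : ℕ} (s : Finset (Fin N)) {z : α → ℝ} (hz : MemLp z 2 P) :
    MemLp (fun ω => ∑ i ∈ s, z (ω i)) 2 (Measure.pi fun _ : Fin N => P) :=
  memLp_finsetSum s fun i _ =>
    hz.comp_measurePreserving (measurePreserving_eval (fun _ : Fin N => P) i)

/-- Mean absolute deviation of a partial sum of i.i.d. variables. -/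
lemma integral_abs_sum_eval_sub_le {α : Type*} [MeasurableSpace α] {P : Measure α}
    [IsProbabilityMeasure P] {N : ℕ} (s : Finset (Fin N)) {z : α → ℝ} (hz : MemLp z 2 P) :
    ∫ ω, |∑ i ∈ s, z (ω i) - s.card * ∫ x, z x ∂P| ∂(Measure.pi fun _ : Fin N => P)
      ≤ √(s.card * ∫ x, z x ^ 2 ∂P) := by
  have hsum := memLp_sum_eval s hz
  have hmean : ∫ ω, ∑ i ∈ s, z (ω i) ∂(Measure.pi fun _ : Fin N => P)
      = s.card * ∫ x, z x ∂P := by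
    rw [integral_finsetSum _ fun i _ => integrable_comp_eval (hz.integrable one_le_two)]
    simp [integral_comp_eval (μ := fun _ : Fin N => P) hz.aestronglyMeasurable]
  refine (integral_abs_le_sqrt_integral_sq (hsum.sub (memLp_const _))).trans
    (Real.sqrt_le_sqrt ?_)
  have hvar : ProbabilityTheory.variance (fun ω => ∑ i ∈ s, z (ω i))
      (Measure.pi fun _ : Fin N => P) = s.card * ProbabilityTheory.variance z P := by
    have h := ProbabilityTheory.variance_sum_pi (μ := fun _ : Fin N => P)
      (X := fun i => if i ∈ s then z else 0) (fun i => by split_ifs; exacts [hz, MemLp.zero])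
    have e : (∑ i, fun ω : Fin N → α => (if i ∈ s then z else 0) (ω i))
        = fun ω => ∑ i ∈ s, z (ω i) := by
      ext ω
      simp [Finset.sum_apply, ite_apply, Finset.sum_ite_mem]
    rw [e] at h
    rw [h]
    simp [apply_ite (fun f => ProbabilityTheory.variance f P),
      Finset.sum_ite_mem]
  rw [ProbabilityTheory.variance_eq_integral hsum.aestronglyMeasurable.aemeasurable, hmean]
    at hvar
  simp only [Pi.sub_apply]
  rw [hvar]
  exact mul_le_mul_of_nonneg_left
    (ProbabilityTheory.variance_le_expectation_sq hz.aestronglyMeasurable) (by positivity)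

/-! ## Bins and signed label counts -/

/-- The `j`-th of the `K` bins of `[0, 1)`. -/
def bin (K j : ℕ) : Set ℝ := Ico ((j:ℝ)/(K:ℝ)) (((j:ℝ)+1)/(K:ℝ))

lemma measurableSet_bin (K j : ℕ) : MeasurableSet (bin K j) := measurableSet_Ico

lemma measurableSet_bin_prod (K j : ℕ) (t : Set Bool) : MeasurableSet (bin K j ×ˢ t) :=
  (measurableSet_bin K j).prod (MeasurableSet.of_discrete)

lemma mem_bin_iff {K j : ℕ} (hK : 0 < K) {x : ℝ} :
    x ∈ bin K j ↔ 0 ≤ x ∧ ⌊x * (K:ℝ)⌋₊ = j := by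
  have hK' : (0:ℝ) < K := by exact_mod_cast hK
  rw [bin, mem_Ico, div_le_iff₀ hK', lt_div_iff₀ hK']
  constructor
  · rintro ⟨h1, h2⟩
    have h0 : 0 ≤ x * K := le_trans (Nat.cast_nonneg j) h1
    exact ⟨nonneg_of_mul_nonneg_left h0 hK', (Nat.floor_eq_iff h0).2 ⟨h1, h2⟩⟩
  · rintro ⟨h0, h⟩
    exact (Nat.floor_eq_iff (by positivity)).1 h

lemma pairwise_disjoint_bin {K : ℕ} (hK : 0 < K) : Pairwise (Function.onFun Disjoint (bin K)) := by
  intro i j hij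
  refine Set.disjoint_left.2 fun x hi hj => hij ?_
  rw [← ((mem_bin_iff hK).1 hi).2, ((mem_bin_iff hK).1 hj).2]

lemma exists_mem_bin {K : ℕ} (hK : 0 < K) {x : ℝ} (hx : x ∈ Ico (0:ℝ) 1) :
    ∃ j < K, x ∈ bin K j := by
  have hK' : (0:ℝ) < K := by exact_mod_cast hK
  refine ⟨⌊x * (K:ℝ)⌋₊, ?_, (mem_bin_iff hK).2 ⟨hx.1, rfl⟩⟩
  rw [Nat.floor_lt (by nlinarith [hx.1])]
  nlinarith [hx.2]

/-- The label, coded as `±1`, of an example whose feature lies in `B`, and `0` otherwise. -/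
def signedIndicator (B : Set ℝ) (p : ℝ × Bool) : ℝ :=
  (B ×ˢ {true}).indicator 1 p - (B ×ˢ {false}).indicator 1 p

lemma memLp_signedIndicator {B : Set ℝ} (hB : MeasurableSet B) (P : Measure (ℝ × Bool))
    [IsProbabilityMeasure P] : MemLp (signedIndicator B) 2 P := by
  refine MemLp.sub ?_ ?_ <;>
  exact (memLp_const (1:ℝ)).indicator (hB.prod (MeasurableSet.of_discrete))

lemma integral_signedIndicator {B : Set ℝ} (hB : MeasurableSet B) (P : Measure (ℝ × Bool))
    [IsProbabilityMeasure P] :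
    ∫ p, signedIndicator B p ∂P = P.real (B ×ˢ {true}) - P.real (B ×ˢ {false}) := by
  have h (t : Set Bool) : MeasurableSet (B ×ˢ t) := hB.prod (MeasurableSet.of_discrete)
  unfold signedIndicator
  rw [integral_sub (by exact (integrable_const (1:ℝ)).indicator (h _))
    (by exact (integrable_const (1:ℝ)).indicator (h _)), integral_indicator_one (h _),
    integral_indicator_one (h _)]

lemma integral_signedIndicator_sq {B : Set ℝ} (hB : MeasurableSet B) (P : Measure (ℝ × Bool)) :
    ∫ p, signedIndicator B p ^ 2 ∂P = P.real (B ×ˢ univ) := by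
  rw [← integral_indicator_one (hB.prod MeasurableSet.univ)]
  congr 1
  ext ⟨x, y⟩
  by_cases hx : x ∈ B <;> cases y <;> simp [signedIndicator, hx]

lemma sum_signedIndicator {N : ℕ} (s : Finset (Fin N)) (a b : ℝ) (ω : Fin N → ℝ × Bool) :
    ∑ i ∈ s, signedIndicator (Ico a b) (ω i) =
      ((s.filter fun i => (ω i).2 = true ∧ (ω i).1 ∈ Ico a b).card : ℝ)
        - (s.filter fun i => (ω i).2 = false ∧ (ω i).1 ∈ Ico a b).card := by
  simp only [signedIndicator, Finset.sum_sub_distrib, Finset.card_filter, Nat.cast_sum]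
  congr 1 <;>
  · refine Finset.sum_congr rfl fun i _ => ?_
    simp [indicator_apply, and_comm]

lemma usbBinPred_eq (nmaj nmin K : ℕ) (s : Finset (Fin nmaj)) (S : Sample nmaj nmin) (j : ℕ) :
    usbBinPred nmaj nmin K s S j = decide
      (0 < ∑ i ∈ s, signedIndicator (bin K j) (S.1 i)
        + ∑ i, signedIndicator (bin K j) (S.2 i)) := by
  unfold bin
  rw [usbBinPred, decide_eq_decide, sum_signedIndicator, sum_signedIndicator,
    ← Nat.cast_lt (α := ℝ), Nat.cast_add, Nat.cast_add]
  constructor <;> intro h <;> linarith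

/-! ## Group-shift distributions -/

lemma labelMeasure_apply (p : ℝ → ℝ) (y : Bool) {A : Set (ℝ × Bool)} (hA : MeasurableSet A) :
    labelMeasure p y A = ∫⁻ x in {x | (x, y) ∈ A} ∩ Icc 0 1, ENNReal.ofReal (p x) := by
  have hm : Measurable fun x : ℝ => (x, y) := by fun_prop
  rw [labelMeasure, Measure.map_apply hm hA, withDensity_apply _ (hm hA),
    Measure.restrict_restrict (hm hA)]
  rfl

lemma covMeasure_prod_singleton (p η : ℝ → ℝ) {E : Set ℝ} (hE : MeasurableSet E) (y : Bool) :
    covMeasure p η (E ×ˢ {y}) =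
      ∫⁻ x in E ∩ Icc 0 1, ENNReal.ofReal (p x * if y then η x else 1 - η x) := by
  have hA : MeasurableSet (E ×ˢ ({y} : Set Bool)) := hE.prod (MeasurableSet.of_discrete)
  rw [covMeasure, Measure.add_apply, labelMeasure_apply _ _ hA, labelMeasure_apply _ _ hA]
  cases y <;> simp

section Density

variable {p η : ℝ → ℝ}

lemma integrableOn_density (hint : ∫ x in Icc (0:ℝ) 1, p x = 1) :
    IntegrableOn p (Icc (0:ℝ) 1) := by
  by_contra h
  rw [integral_undef h] at hint
  exact zero_ne_one hint

lemma aemeasurable_of_lipschitzOnWith (hη : LipschitzOnWith 1 η (Icc 0 1)) :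
    AEMeasurable η (volume.restrict (Icc (0:ℝ) 1)) :=
  hη.continuousOn.aemeasurable measurableSet_Icc

lemma isProbabilityMeasure_covMeasure (hp : ∀ x, 0 ≤ p x)
    (hint : ∫ x in Icc (0:ℝ) 1, p x = 1) (h01 : ∀ x, 0 ≤ η x ∧ η x ≤ 1)
    (hη : LipschitzOnWith 1 η (Icc 0 1)) : IsProbabilityMeasure (covMeasure p η) := by
  have hpm := (integrableOn_density hint).aemeasurable
  have hηm := aemeasurable_of_lipschitzOnWith hη
  constructor
  rw [covMeasure, Measure.add_apply, labelMeasure_apply _ _ MeasurableSet.univ,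
    labelMeasure_apply _ _ MeasurableSet.univ]
  simp only [mem_univ, ofPred_true, univ_inter]
  rw [← lintegral_add_left' (f := fun x => ENNReal.ofReal (p x * η x))
    (hpm.mul hηm).ennreal_ofReal]
  have h (x : ℝ) : ENNReal.ofReal (p x * η x) + ENNReal.ofReal (p x * (1 - η x))
      = ENNReal.ofReal (p x) := by
    rw [← ENNReal.ofReal_add (mul_nonneg (hp x) (h01 x).1)
      (mul_nonneg (hp x) (sub_nonneg.2 (h01 x).2))]
    ring_nf
  simp only [h]
  rw [← ofReal_integral_eq_lintegral_ofReal (integrableOn_density hint)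
    (Filter.Eventually.of_forall hp), hint, ENNReal.ofReal_one]

lemma covMeasure_compl_Ico (p η : ℝ → ℝ) : covMeasure p η ((Ico (0:ℝ) 1)ᶜ ×ˢ univ) = 0 := by
  have hA : MeasurableSet ((Ico (0:ℝ) 1)ᶜ ×ˢ (univ : Set Bool)) :=
    measurableSet_Ico.compl.prod MeasurableSet.univ
  have h0 : volume ((Ico (0:ℝ) 1)ᶜ ∩ Icc 0 1) = 0 := by
    refine measure_mono_null (t := {(1:ℝ)}) ?_ (by simp)
    rintro x ⟨hx, hx'⟩
    simp only [mem_compl_iff, mem_Ico, not_and, not_lt] at hx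
    exact le_antisymm hx'.2 (hx hx'.1)
  rw [covMeasure, Measure.add_apply, labelMeasure_apply _ _ hA, labelMeasure_apply _ _ hA]
  simp only [mem_prod, mem_univ, and_true, ofPred_mem_eq]
  simp [setLIntegral_measure_zero _ _ h0]

/-- The Bayes label at the left end point of a bin is nearly optimal on the whole bin. -/
lemma covMeasure_label_compare (hp : ∀ x, 0 ≤ p x) (hint : ∫ x in Icc (0:ℝ) 1, p x = 1)
    (h01 : ∀ x, 0 ≤ η x ∧ η x ≤ 1) (hη : LipschitzOnWith 1 η (Icc 0 1))
    {K j : ℕ} (hj : j < K) {E : Set ℝ} (hE : MeasurableSet E) (hEj : E ⊆ bin K j) :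
    covMeasure p η (E ×ˢ {!decide (1/2 ≤ η (j/K))}) ≤
      covMeasure p η (E ×ˢ {decide (1/2 ≤ η (j/K))})
        + ENNReal.ofReal (2/K) * covMeasure p η (E ×ˢ univ) := by
  have hK : (0:ℝ) < K := by exact_mod_cast hj.pos
  have hjK : (j:ℝ) < K := by exact_mod_cast hj
  have hpm : AEMeasurable p (volume.restrict (E ∩ Icc (0:ℝ) 1)) :=
    (integrableOn_density hint).aemeasurable.mono_measure (Measure.restrict_mono inter_subset_right le_rfl)
  have hηm : AEMeasurable η (volume.restrict (E ∩ Icc (0:ℝ) 1)) :=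
    (aemeasurable_of_lipschitzOnWith hη).mono_measure
      (Measure.restrict_mono inter_subset_right le_rfl)
  have huniv : covMeasure p η (E ×ˢ univ)
      = ∫⁻ x in E ∩ Icc 0 1, (ENNReal.ofReal (p x * η x) + ENNReal.ofReal (p x * (1 - η x))) := by
    have hA : MeasurableSet (E ×ˢ (univ : Set Bool)) := hE.prod MeasurableSet.univ
    rw [lintegral_add_left' (f := fun x => ENNReal.ofReal (p x * η x))
        (hpm.mul hηm).ennreal_ofReal, covMeasure, Measure.add_apply,
      labelMeasure_apply _ _ hA, labelMeasure_apply _ _ hA]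
    simp
  have hc : AEMeasurable (fun x => ENNReal.ofReal
      (p x * if decide (1/2 ≤ η (j/K)) then η x else 1 - η x))
      (volume.restrict (E ∩ Icc (0:ℝ) 1)) := by
    refine AEMeasurable.ennreal_ofReal (hpm.mul ?_)
    split_ifs
    exacts [hηm, aemeasurable_const.sub hηm]
  rw [covMeasure_prod_singleton _ _ hE, covMeasure_prod_singleton _ _ hE, huniv,
    ← lintegral_const_mul' _ _ ENNReal.ofReal_ne_top, ← lintegral_add_left' hc]
  refine setLIntegral_mono_ae' (hE.inter measurableSet_Icc) (Filter.Eventually.of_forall ?_)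
  rintro x ⟨hxE, hx⟩
  have hpx := hp x
  obtain ⟨h0, h1⟩ := h01 x
  have hbin := hEj hxE
  rw [bin, mem_Ico, add_div] at hbin
  have hmem : (j:ℝ)/K ∈ Icc (0:ℝ) 1 := ⟨by positivity, (div_le_one hK).2 hjK.le⟩
  have hl : |η x - η (j/K)| ≤ 1/K := by
    have := hη.dist_le_mul x hx _ hmem
    rw [Real.dist_eq, Real.dist_eq] at this
    refine this.trans ?_
    rw [NNReal.coe_one, one_mul, abs_of_nonneg (by linarith)]
    linarith
  rw [abs_le] at hl
  have h2 : (2:ℝ)/K = 2 * (1/K) := by ring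
  rw [← ENNReal.ofReal_add (by positivity) (mul_nonneg hpx (by linarith)),
    ← ENNReal.ofReal_mul (by positivity), ← ENNReal.ofReal_add]
  · apply ENNReal.ofReal_le_ofReal
    by_cases hd : 1/2 ≤ η (j/K)
    · simp only [hd, decide_true, Bool.not_true, Bool.false_eq_true, if_true, if_false, h2]
      nlinarith
    · simp only [hd, decide_false, Bool.not_false, Bool.false_eq_true, if_true, if_false, h2]
      push Not at hd
      nlinarith
  · refine mul_nonneg hpx ?_
    split_ifs <;> linarith
  · have : 0 ≤ p x * η x + p x * (1 - η x) := by nlinarith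
    positivity

end Density

/-! ## Risk bounds -/

section Risk

variable {P : Measure (ℝ × Bool)} [IsProbabilityMeasure P] {K : ℕ}

lemma sum_measureReal_bin_le_one (hK : 0 < K) :
    ∑ j ∈ Finset.range K, P.real (bin K j ×ˢ univ) ≤ 1 := by
  have h := sum_measure_le_measure_univ (μ := P) (s := Finset.range K)
    (t := fun j => bin K j ×ˢ univ)
    (fun j _ => (measurableSet_bin_prod K j _).nullMeasurableSet)
    (fun i _ j _ hij => (Set.disjoint_prod.2
      (Or.inl (pairwise_disjoint_bin hK hij))).aedisjoint)
  rw [measure_univ] at h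
  have := ENNReal.toReal_mono ENNReal.one_ne_top h
  rwa [ENNReal.toReal_sum (fun _ _ => measure_ne_top _ _), ENNReal.toReal_one] at this

/-- Upper bound for the risk of a classifier that is constant on every bin. -/
lemma risk_le_sum_bin (hK : 0 < K) (hnull : P ((Ico (0:ℝ) 1)ᶜ ×ˢ univ) = 0)
    {f : ℝ → Bool} {b : ℕ → Bool} (hf : ∀ j < K, ∀ x ∈ bin K j, f x = b j) :
    risk f P ≤ ∑ j ∈ Finset.range K, P.real (bin K j ×ˢ {!b j}) := by
  have hsub : {q : ℝ × Bool | f q.1 ≠ q.2} ⊆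
      (⋃ j ∈ Finset.range K, bin K j ×ˢ {!b j}) ∪ ((Ico (0:ℝ) 1)ᶜ ×ˢ univ) := by
    rintro ⟨x, y⟩ hxy
    by_cases hx : x ∈ Ico (0:ℝ) 1
    · obtain ⟨j, hj, hxj⟩ := exists_mem_bin hK hx
      refine Or.inl (mem_biUnion (Finset.mem_coe.2 (Finset.mem_range.2 hj)) ⟨hxj, ?_⟩)
      simp only [mem_ofPred_eq, hf j hj x hxj] at hxy
      simp only [mem_singleton_iff]
      exact (Bool.not_eq.2 hxy).symm ▸ by simp
    · exact Or.inr ⟨hx, mem_univ _⟩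
  have h : P {q : ℝ × Bool | f q.1 ≠ q.2} ≤
      ∑ j ∈ Finset.range K, P (bin K j ×ˢ {!b j}) := by
    refine (measure_mono hsub).trans ((measure_union_le _ _).trans ?_)
    rw [hnull, add_zero]
    exact measure_biUnion_finset_le _ _
  have := ENNReal.toReal_mono (by simp [measure_ne_top]) h
  rwa [ENNReal.toReal_sum (fun _ _ => measure_ne_top _ _)] at this

/-- Every classifier has risk at least that of the binwise labels `c`, up to the accuracy with
which these labels are optimal on subsets of the bins. -/
lemma sum_bin_le_risk_add {ε : ℝ} (hε : 0 ≤ ε) (hK : 0 < K) {c : ℕ → Bool}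
    (hc : ∀ j < K, ∀ E ⊆ bin K j, MeasurableSet E →
      P (E ×ˢ {!c j}) ≤ P (E ×ˢ {c j}) + ENNReal.ofReal ε * P (E ×ˢ univ)) (f : ℝ → Bool) :
    ∑ j ∈ Finset.range K, P.real (bin K j ×ˢ {!c j}) ≤ risk f P + ε := by
  set A := toMeasurable P {q : ℝ × Bool | f q.1 ≠ q.2} with hAdef
  have hA : MeasurableSet A := measurableSet_toMeasurable _ _
  have hfA : {q : ℝ × Bool | f q.1 ≠ q.2} ⊆ A := subset_toMeasurable _ _
  have hrisk : risk f P = P.real A := by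
    rw [risk, measureReal_def, hAdef, measure_toMeasurable]
  have key : ∀ j < K, P.real (bin K j ×ˢ {!c j}) ≤
      P.real (A ∩ bin K j ×ˢ univ) + ε * P.real (bin K j ×ˢ univ) := by
    intro j hj
    have hm (y : Bool) : MeasurableSet {x : ℝ | (x, y) ∈ A} :=
      (by fun_prop : Measurable fun x : ℝ => (x, y)) hA
    set V := {x : ℝ | (x, !c j) ∈ A}
    have hE : MeasurableSet (bin K j \ V) := (measurableSet_bin K j).diff (hm _)
    have hEsub : bin K j \ V ⊆ bin K j := sdiff_subset
    have h1 : P.real ((bin K j \ V) ×ˢ {!c j}) ≤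
        P.real ((bin K j \ V) ×ˢ {c j}) + ε * P.real (bin K j ×ˢ univ) := by
      have h := ENNReal.toReal_mono (by finiteness) (hc j hj _ hEsub hE)
      rw [ENNReal.toReal_add (by finiteness) (by finiteness), ENNReal.toReal_mul,
        ENNReal.toReal_ofReal hε] at h
      exact h.trans (add_le_add le_rfl
        (mul_le_mul_of_nonneg_left (measureReal_mono (prod_mono_left hEsub)) hε))
    have h2 : P.real (bin K j ×ˢ {!c j}) ≤
        P.real ((bin K j ∩ V) ×ˢ {!c j}) + P.real ((bin K j \ V) ×ˢ {!c j}) := by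
      refine le_trans (measureReal_mono ?_) (measureReal_union_le _ _)
      rw [← union_prod, inter_union_sdiff]
    have h3 : P.real ((bin K j ∩ V) ×ˢ {!c j}) + P.real ((bin K j \ V) ×ˢ {c j}) ≤
        P.real (A ∩ bin K j ×ˢ univ) := by
      rw [← measureReal_union (Set.disjoint_prod.2 (Or.inr (by simp)))
        (hE.prod MeasurableSet.of_discrete)]
      refine measureReal_mono ?_
      rintro ⟨x, y⟩ (⟨⟨hx, hxV⟩, hy⟩ | ⟨⟨hx, hxV⟩, hy⟩)
      · obtain rfl : y = !c j := hy
        exact ⟨hxV, hx, mem_univ _⟩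
      · obtain rfl : y = c j := hy
        refine ⟨hfA fun hfx => hxV (hfA ?_), hx, mem_univ _⟩
        simp only at hfx
        simp [hfx]
    linarith
  have hsumA : ∑ j ∈ Finset.range K, P.real (A ∩ bin K j ×ˢ univ) ≤ P.real A := by
    rw [← measureReal_biUnion_finset]
    · exact measureReal_mono (iUnion₂_subset fun j _ => inter_subset_left)
    · intro i _ j _ hij
      exact (Set.disjoint_prod.2 (Or.inl (pairwise_disjoint_bin hK hij))).mono
        inter_subset_right inter_subset_right
    · exact fun j _ => hA.inter (measurableSet_bin_prod K j _)
  calc ∑ j ∈ Finset.range K, P.real (bin K j ×ˢ {!c j})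
      ≤ ∑ j ∈ Finset.range K,
          (P.real (A ∩ bin K j ×ˢ univ) + ε * P.real (bin K j ×ˢ univ)) :=
        Finset.sum_le_sum fun j hj => key j (Finset.mem_range.1 hj)
    _ = ∑ j ∈ Finset.range K, P.real (A ∩ bin K j ×ˢ univ)
          + ε * ∑ j ∈ Finset.range K, P.real (bin K j ×ˢ univ) := by
        rw [Finset.sum_add_distrib, Finset.mul_sum]
    _ ≤ P.real A + ε * 1 := by
        gcongr
        exact sum_measureReal_bin_le_one hK
    _ = risk f P + ε := by rw [hrisk, mul_one]

lemma sum_sqrt_bin_le (hK : 0 < K) (n : ℕ) :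
    ∑ j ∈ Finset.range K, √(n * P.real (bin K j ×ˢ univ)) ≤ √(n * K) := by
  apply Real.le_sqrt_of_sq_le
  refine sq_sum_le_card_mul_sum_sq.trans ?_
  simp only [Real.sq_sqrt (mul_nonneg (Nat.cast_nonneg n) measureReal_nonneg), Finset.card_range,
    ← Finset.mul_sum]
  have := sum_measureReal_bin_le_one (P := P) hK
  nlinarith [mul_nonneg (Nat.cast_nonneg (α := ℝ) K) (Nat.cast_nonneg (α := ℝ) n)]

end Risk

/-- A label chosen by the sign of an estimate `T` of `2n (q₊ - q₋)` is wrong by at most the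
estimation error. -/
lemma label_error_le {q : Bool → ℝ} {n T : ℝ} (hn : 0 < n) (c : Bool) :
    q (!decide (0 < T)) ≤ q (!c) + |T - 2 * n * (q true - q false)| / (2 * n) := by
  have h0 : 0 ≤ |T - 2 * n * (q true - q false)| / (2 * n) := by positivity
  have h1 := le_abs_self (T - 2 * n * (q true - q false))
  have h2 := neg_abs_le (T - 2 * n * (q true - q false))
  by_cases hT : 0 < T <;> cases c <;> simp only [hT, decide_true, decide_false, Bool.not_true,
    Bool.not_false]
  · rw [← sub_le_iff_le_add', le_div_iff₀ (by positivity)]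
    nlinarith
  · linarith
  · linarith
  · rw [← sub_le_iff_le_add', le_div_iff₀ (by positivity)]
    nlinarith

section TestMeasure

variable {Pmaj Pmin : Measure (ℝ × Bool)} [IsProbabilityMeasure Pmaj] [IsProbabilityMeasure Pmin]

instance isProbabilityMeasure_testMeasure : IsProbabilityMeasure (testMeasure Pmaj Pmin) := by
  constructor
  simp [testMeasure, ENNReal.inv_two_add_inv_two]

lemma testMeasure_real (A : Set (ℝ × Bool)) :
    (testMeasure Pmaj Pmin).real A = (Pmaj.real A + Pmin.real A) / 2 := by
  rw [measureReal_def, testMeasure, Measure.add_apply, Measure.smul_apply, Measure.smul_apply,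
    smul_eq_mul, smul_eq_mul, ENNReal.toReal_add (by finiteness) (by finiteness),
    ENNReal.toReal_mul, ENNReal.toReal_mul, measureReal_def, measureReal_def]
  simp
  ring

lemma integrable_abs_dev {N : ℕ} {P : Measure (ℝ × Bool)} [IsProbabilityMeasure P]
    (s : Finset (Fin N)) {B : Set ℝ} (hB : MeasurableSet B) :
    Integrable (fun ω => |∑ i ∈ s, signedIndicator B (ω i)
      - s.card * ∫ p, signedIndicator B p ∂P|) (Measure.pi fun _ : Fin N => P) :=
  (((memLp_sum_eval s (memLp_signedIndicator hB P)).integrable one_le_two).sub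
    (integrable_const _)).abs

/-- Expected risk of the undersampled binning classifier for a fixed undersampling set. -/
lemma integral_risk_usbClassifier_le {nmaj nmin K : ℕ} (hn : 0 < nmin) (hK : 0 < K)
    (hnull : testMeasure Pmaj Pmin ((Ico (0:ℝ) 1)ᶜ ×ˢ univ) = 0)
    {s : Finset (Fin nmaj)} (hs : s.card = nmin) (c : ℕ → Bool) :
    ∫ S, risk (usbClassifier nmaj nmin K s S) (testMeasure Pmaj Pmin)
        ∂sampleMeasure nmaj nmin Pmaj Pmin ≤
      ∑ j ∈ Finset.range K, (testMeasure Pmaj Pmin).real (bin K j ×ˢ {!c j})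
        + √(nmin * K) / nmin := by
  set P := testMeasure Pmaj Pmin with hP
  have hn' : (0:ℝ) < nmin := by exact_mod_cast hn
  let dmaj (j : ℕ) (ω : Fin nmaj → ℝ × Bool) : ℝ :=
    |∑ i ∈ s, signedIndicator (bin K j) (ω i) - s.card * ∫ p, signedIndicator (bin K j) p ∂Pmaj|
  let dmin (j : ℕ) (ω : Fin nmin → ℝ × Bool) : ℝ :=
    |∑ i, signedIndicator (bin K j) (ω i)
      - (Finset.univ : Finset (Fin nmin)).card * ∫ p, signedIndicator (bin K j) p ∂Pmin|
  have hpt (S : Sample nmaj nmin) : risk (usbClassifier nmaj nmin K s S) P ≤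
      ∑ j ∈ Finset.range K,
        (P.real (bin K j ×ˢ {!c j}) + (dmaj j S.1 + dmin j S.2) / (2 * nmin)) := by
    refine (risk_le_sum_bin hK hnull (b := usbBinPred nmaj nmin K s S) ?_).trans
      (Finset.sum_le_sum fun j _ => ?_)
    · intro j hj x hx
      rw [usbClassifier, ((mem_bin_iff hK).1 hx).2, min_eq_left (by omega)]
    · rw [usbBinPred_eq]
      refine (label_error_le (q := fun y => P.real (bin K j ×ˢ {y})) hn' (c j)).trans ?_
      gcongr
      refine le_trans (le_of_eq ?_) (abs_add_le _ _)
      rw [integral_signedIndicator (measurableSet_bin K j),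
        integral_signedIndicator (measurableSet_bin K j), hP, testMeasure_real, testMeasure_real,
        hs, Finset.card_univ, Fintype.card_fin]
      congr 1
      ring
  have hi1 (j : ℕ) : Integrable (fun S : Sample nmaj nmin => dmaj j S.1)
      (sampleMeasure nmaj nmin Pmaj Pmin) :=
    (integrable_abs_dev s (measurableSet_bin K j)).comp_fst _
  have hi2 (j : ℕ) : Integrable (fun S : Sample nmaj nmin => dmin j S.2)
      (sampleMeasure nmaj nmin Pmaj Pmin) :=
    (integrable_abs_dev Finset.univ (measurableSet_bin K j)).comp_snd _
  have : IsProbabilityMeasure (sampleMeasure nmaj nmin Pmaj Pmin) := by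
    unfold sampleMeasure; infer_instance
  have hi (j : ℕ) : Integrable (fun S : Sample nmaj nmin =>
      P.real (bin K j ×ˢ {!c j}) + (dmaj j S.1 + dmin j S.2) / (2 * nmin))
      (sampleMeasure nmaj nmin Pmaj Pmin) :=
    (integrable_const _).add (((hi1 j).add (hi2 j)).div_const _)
  have hb1 (j : ℕ) : ∫ S, dmaj j S.1 ∂sampleMeasure nmaj nmin Pmaj Pmin ≤
      √(nmin * Pmaj.real (bin K j ×ˢ univ)) := by
    rw [sampleMeasure, integral_fun_fst, probReal_univ, one_smul,
      ← integral_signedIndicator_sq (measurableSet_bin K j), ← hs]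
    exact integral_abs_sum_eval_sub_le s (memLp_signedIndicator (measurableSet_bin K j) Pmaj)
  have hb2 (j : ℕ) : ∫ S, dmin j S.2 ∂sampleMeasure nmaj nmin Pmaj Pmin ≤
      √(nmin * Pmin.real (bin K j ×ˢ univ)) := by
    have h := integral_abs_sum_eval_sub_le (Finset.univ : Finset (Fin nmin))
      (memLp_signedIndicator (measurableSet_bin K j) Pmin)
    rw [integral_signedIndicator_sq (measurableSet_bin K j)] at h
    rw [sampleMeasure, integral_fun_snd, probReal_univ, one_smul]
    refine h.trans (le_of_eq ?_)
    rw [Finset.card_univ, Fintype.card_fin]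
  calc _ ≤ ∫ S, ∑ j ∈ Finset.range K,
        (P.real (bin K j ×ˢ {!c j}) + (dmaj j S.1 + dmin j S.2) / (2 * nmin))
          ∂sampleMeasure nmaj nmin Pmaj Pmin :=
        integral_mono_of_nonneg (Filter.Eventually.of_forall fun S => ENNReal.toReal_nonneg)
          (integrable_finsetSum _ fun j _ => hi j) (Filter.Eventually.of_forall hpt)
    _ = ∑ j ∈ Finset.range K, (P.real (bin K j ×ˢ {!c j})
          + (∫ S, dmaj j S.1 ∂sampleMeasure nmaj nmin Pmaj Pmin
            + ∫ S, dmin j S.2 ∂sampleMeasure nmaj nmin Pmaj Pmin) / (2 * nmin)) := by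
        rw [integral_finsetSum _ fun j _ => hi j]
        refine Finset.sum_congr rfl fun j _ => ?_
        rw [integral_add (g := fun S : Sample nmaj nmin => (dmaj j S.1 + dmin j S.2) / (2 * nmin))
            (integrable_const _) (((hi1 j).add (hi2 j)).div_const _),
          integral_div, integral_add (hi1 j) (hi2 j), integral_const, probReal_univ, one_smul]
    _ ≤ ∑ j ∈ Finset.range K, (P.real (bin K j ×ˢ {!c j})
          + (√(nmin * Pmaj.real (bin K j ×ˢ univ))
            + √(nmin * Pmin.real (bin K j ×ˢ univ))) / (2 * nmin)) := by
        gcongr with j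
        exacts [hb1 j, hb2 j]
    _ = ∑ j ∈ Finset.range K, P.real (bin K j ×ˢ {!c j})
          + (∑ j ∈ Finset.range K, √(nmin * Pmaj.real (bin K j ×ˢ univ))
            + ∑ j ∈ Finset.range K, √(nmin * Pmin.real (bin K j ×ˢ univ))) / (2 * nmin) := by
        rw [Finset.sum_add_distrib, ← Finset.sum_div, Finset.sum_add_distrib]
    _ ≤ ∑ j ∈ Finset.range K, P.real (bin K j ×ˢ {!c j})
          + (√(nmin * K) + √(nmin * K)) / (2 * nmin) := by
        gcongr <;> exact sum_sqrt_bin_le hK nmin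
    _ = _ := by
        field_simp
        ring

end TestMeasure

/-- Finite-sample bound for an arbitrary number of bins. -/
lemma usbExcessRisk_le {nmaj nmin K : ℕ} (hn : 0 < nmin) (hlt : nmin < nmaj) (hK : 0 < K)
    {τ : ℝ} {Pmaj Pmin : Measure (ℝ × Bool)} (hGS : memGS τ Pmaj Pmin) :
    usbExcessRisk nmaj nmin K Pmaj Pmin ≤ 2 / K + √(nmin * K) / nmin := by
  obtain ⟨pa, pb, η, hpa, hpb, hia, hib, h01, hη, -, -, rfl, rfl⟩ := hGS
  have := isProbabilityMeasure_covMeasure hpa hia h01 hη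
  have := isProbabilityMeasure_covMeasure hpb hib h01 hη
  set P := testMeasure (covMeasure pa η) (covMeasure pb η) with hP
  let c (j : ℕ) : Bool := decide (1/2 ≤ η (j/K))
  have hnull : P ((Ico (0:ℝ) 1)ᶜ ×ˢ univ) = 0 := by
    simp only [hP, testMeasure, Measure.add_apply, Measure.smul_apply, covMeasure_compl_Ico,
      smul_zero, add_zero]
  have hcomp : ∀ j < K, ∀ E ⊆ bin K j, MeasurableSet E →
      P (E ×ˢ {!c j}) ≤ P (E ×ˢ {c j}) + ENNReal.ofReal (2/K) * P (E ×ˢ univ) := by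
    intro j hj E hE hEm
    have h1 := covMeasure_label_compare hpa hia h01 hη hj hEm hE
    have h2 := covMeasure_label_compare hpb hib h01 hη hj hEm hE
    simp only [hP, testMeasure, Measure.add_apply, Measure.smul_apply, smul_eq_mul]
    refine (add_le_add (mul_le_mul_right h1 _) (mul_le_mul_right h2 _)).trans (le_of_eq ?_)
    ring
  have hbayes : ∑ j ∈ Finset.range K, P.real (bin K j ×ˢ {!c j}) - 2 / K ≤ bayesRisk P :=
    le_ciInf fun f => by
      have := sum_bin_le_risk_add (P := P) (ε := 2/K) (by positivity) hK hcomp f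
      linarith
  have hcard : 0 < (Finset.powersetCard nmin (Finset.univ : Finset (Fin nmaj))).card := by
    rw [Finset.card_powersetCard, Finset.card_univ, Fintype.card_fin]
    exact Nat.choose_pos hlt.le
  have havg : (∑ s ∈ Finset.powersetCard nmin (Finset.univ : Finset (Fin nmaj)),
      ∫ S, risk (usbClassifier nmaj nmin K s S) P
        ∂sampleMeasure nmaj nmin (covMeasure pa η) (covMeasure pb η))
      / ((Finset.powersetCard nmin (Finset.univ : Finset (Fin nmaj))).card : ℝ)
      ≤ ∑ j ∈ Finset.range K, P.real (bin K j ×ˢ {!c j}) + √(nmin * K) / nmin := by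
    rw [div_le_iff₀ (by exact_mod_cast hcard), mul_comm, ← nsmul_eq_mul]
    exact Finset.sum_le_card_nsmul _ _ _ fun s hs =>
      integral_risk_usbClassifier_le hn hK hnull (Finset.mem_powersetCard.1 hs).2 c
  rw [usbExcessRisk]
  linarith

/-- **Theorem (group-covariate shift upper bound for undersampled binning).** There is an
absolute constant `C > 0` such that for every overlap `τ ∈ [0,1]` and every
`(P_maj, P_min) ∈ 𝒫_GS(τ)`, the expected excess risk of the undersampled binning
estimator with `K = ⌈n_min^{1/3}⌉` bins is at most `C / n_min^{1/3}`. -/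
theorem undersampled_binning_group_shift_upper_bound :
    ∃ C : ℝ, 0 < C ∧
      ∀ (nmaj nmin : ℕ), 1 ≤ nmin → nmin < nmaj →
        ∀ τ : ℝ, τ ∈ Icc (0:ℝ) 1 →
          ∀ Pmaj Pmin : Measure (ℝ × Bool), memGS τ Pmaj Pmin →
            usbExcessRisk nmaj nmin ⌈(nmin : ℝ) ^ ((1:ℝ)/3)⌉₊ Pmaj Pmin ≤
              C / (nmin : ℝ) ^ ((1:ℝ)/3) := by
  refine ⟨4, by norm_num, fun nmaj nmin hn hlt τ _ Pmaj Pmin hGS => ?_⟩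
  have hn' : (1:ℝ) ≤ nmin := by exact_mod_cast hn
  set r : ℝ := (nmin : ℝ) ^ ((1:ℝ)/3) with hr
  have hr1 : 1 ≤ r := Real.one_le_rpow hn' (by norm_num)
  have hr3 : r ^ 3 = nmin := by
    rw [hr, ← Real.rpow_natCast, ← Real.rpow_mul (by positivity)]
    norm_num
  have hK : 0 < ⌈r⌉₊ := Nat.ceil_pos.2 (by linarith)
  refine (usbExcessRisk_le hn hlt hK hGS).trans ?_
  have hK1 : r ≤ ⌈r⌉₊ := Nat.le_ceil r
  have hK2 : (⌈r⌉₊ : ℝ) ≤ 2 * r := by linarith [Nat.ceil_lt_add_one (by linarith : 0 ≤ r)]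
  have h1 : (2:ℝ) / ⌈r⌉₊ ≤ 2 / r := by gcongr
  have h2 : √(nmin * ⌈r⌉₊) / nmin ≤ 2 / r := by
    have h3 : √(nmin * ⌈r⌉₊) ≤ 2 * r ^ 2 := by
      apply Real.sqrt_le_iff.2 ⟨by positivity, ?_⟩
      rw [← hr3]
      nlinarith [mul_le_mul_of_nonneg_left hK2 (by positivity : 0 ≤ r ^ 3),
        (by positivity : 0 ≤ r ^ 4)]
    rw [← hr3] at h3 ⊢
    rw [div_le_div_iff₀ (by positivity) (by positivity)]
    nlinarith
  calc (2:ℝ) / ⌈r⌉₊ + √(nmin * ⌈r⌉₊) / nmin ≤ 2 / r + 2 / r := add_le_add h1 h2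
    _ = 4 / r := by ring
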